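/- Let a, b, b', c ∈ ℂ with c and a not nonpositive integers, and let x, y ∈ ℂ with |x| < 1/4 and |y| < 1/4. Then the double series defining F₂(a,b,b',c,a; x, −y/(1−y)) and F₁(b, a−b', b', c; x, x(1−y)) converge absolutely, and (1−y)^(−b') · F₂(a, b, b', c, a; x, −y/(1−y)) = F₁(b, a−b', b', c; x, x(1−y)), where (1−y)^(−b') is the principal branch. -/

import Mathlib

noncomputable section

/-- The ascending Pochhammer symbol `(a)ₙ = a(a+1)⋯(a+n−1)` for a complex number `a`. -/
def poch (a : ℂ) (n : ℕ) : ℂ := (ascPochhammer ℂ n).eval a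

/-- General term of Appell's double series `F₂(a,b,b',c,c';x,y)`. -/
def F2term (a b b' c c' x y : ℂ) (ij : ℕ × ℕ) : ℂ :=
  poch a (ij.1 + ij.2) * poch b ij.1 * poch b' ij.2 /
    (poch c ij.1 * poch c' ij.2 * (Nat.factorial ij.1 : ℂ) * (Nat.factorial ij.2 : ℂ)) *
    x ^ ij.1 * y ^ ij.2

/-- General term of Appell's double series `F₁(a,b,b',c;x,y)`. -/
def F1term (a b b' c x y : ℂ) (ij : ℕ × ℕ) : ℂ :=
  poch a (ij.1 + ij.2) * poch b ij.1 * poch b' ij.2 /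
    (poch c (ij.1 + ij.2) * (Nat.factorial ij.1 : ℂ) * (Nat.factorial ij.2 : ℂ)) *
    x ^ ij.1 * y ^ ij.2

/-- General term of the Gauss hypergeometric series `F(a,b,c;x)`. -/
def Fterm (a b c x : ℂ) (i : ℕ) : ℂ :=
  poch a i * poch b i / (poch c i * (Nat.factorial i : ℂ)) * x ^ i

lemma poch_zero (a : ℂ) : poch a 0 = 1 := by simp [poch]

lemma poch_succ (a : ℂ) (n : ℕ) : poch a (n + 1) = poch a n * (a + n) := by
  simp [poch, ascPochhammer_succ_eval]

lemma poch_add (a : ℂ) (m n : ℕ) : poch a (m + n) = poch a m * poch (a + m) n := by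
  induction n with
  | zero => simp [poch_zero]
  | succ n ih =>
    rw [← add_assoc, poch_succ, ih, poch_succ]
    push_cast
    ring

lemma poch_ne_zero (a : ℂ) (ha : ∀ n : ℕ, a ≠ -(n : ℂ)) (n : ℕ) : poch a n ≠ 0 := by
  induction n with
  | zero => simp [poch_zero]
  | succ n ih =>
    rw [poch_succ]
    refine mul_ne_zero ih ?_
    intro h
    exact ha n (eq_neg_of_add_eq_zero_left h)

lemma poch_one (n : ℕ) : poch 1 n = (Nat.factorial n : ℂ) := by
  simp [poch, ascPochhammer_eval_one]

/-- `(r)ₙ / n!`. -/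
def qp (r : ℂ) (n : ℕ) : ℂ := poch r n / (Nat.factorial n : ℂ)

lemma qp_eq_multichoose (r : ℂ) (n : ℕ) : qp r n = Ring.multichoose r n := by
  have h := Ring.factorial_nsmul_multichoose_eq_ascPochhammer r n
  rw [Polynomial.ascPochhammer_smeval_eq_eval, nsmul_eq_mul] at h
  have hn : (Nat.factorial n : ℂ) ≠ 0 := by exact_mod_cast Nat.factorial_ne_zero n
  rw [qp, poch, ← h]
  field_simp

lemma choose_neg_eq (r : ℂ) (n : ℕ) : Ring.choose (-r) n = (-1) ^ n * qp r n := by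
  rw [qp_eq_multichoose, Ring.multichoose_eq, Ring.choose_neg]
  simp [Units.smul_def]

lemma qp_add (a b : ℂ) (n : ℕ) :
    qp (a + b) n = ∑ kl ∈ Finset.HasAntidiagonal.antidiagonal n, qp a kl.1 * qp b kl.2 := by
  have h := Ring.add_choose_eq (r := -a) (s := -b) n (Commute.all _ _)
  rw [← neg_add, choose_neg_eq] at h
  have h2 : ((-1 : ℂ) ^ n) * ((-1 : ℂ) ^ n) = 1 := by
    rw [← mul_pow]; simp
  have h3 : qp (a + b) n = (-1) ^ n * ((-1) ^ n * qp (a + b) n) := by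
    rw [← mul_assoc, h2, one_mul]
  rw [h3, h, Finset.mul_sum]
  refine Finset.sum_congr rfl ?_
  intro kl hkl
  rw [Finset.HasAntidiagonal.mem_antidiagonal] at hkl
  rw [choose_neg_eq, choose_neg_eq]
  calc _ = ((-1) ^ n * (-1) ^ (kl.1 + kl.2)) * (qp a kl.1 * qp b kl.2) := by ring
    _ = _ := by rw [hkl, h2, one_mul]

lemma qp_hasSum (r z : ℂ) (hz : ‖z‖ < 1) :
    HasSum (fun n => qp r n * z ^ n) (1 / (1 - z) ^ r) := by
  have h := (Complex.one_div_one_sub_cpow_hasFPowerSeriesOnBall_zero r).hasSum (y := z)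
    (by simpa [Metric.mem_eball, edist_zero_right, ← ofReal_norm] using hz)
  try simp only [zero_add] at h
  have e : (fun n => qp r n * z ^ n) = (fun n => (FormalMultilinearSeries.ofScalars ℂ
      (fun n : ℕ => Ring.choose (r + (n : ℂ) - 1) n) n) fun _ => z) := by
    funext n
    simp [FormalMultilinearSeries.ofScalars, qp_eq_multichoose, Ring.multichoose_eq]
  rw [e]
  exact h

lemma qp_swap (b : ℂ) (j l : ℕ) : qp (b + j) l * qp b j = qp b l * qp (b + l) j := by
  have h1 := poch_add b j l
  have h2 := poch_add b l j
  rw [add_comm l j] at h2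
  unfold qp
  rw [div_mul_div_comm, div_mul_div_comm, ← h2, mul_comm (poch (b + j) l), ← h1, mul_comm]

lemma qp_bound (a : ℂ) : ∃ A : ℕ, ∀ i j : ℕ, ‖qp (a + j) i‖ ≤ 2 ^ A * 2 ^ i * 2 ^ j := by
  obtain ⟨A, hA⟩ := exists_nat_ge ‖a‖
  refine ⟨A, fun i j => ?_⟩
  have h1 : ‖poch (a + j) i‖ ≤ ((A + j).ascFactorial i : ℝ) := by
    induction i with
    | zero => simp [poch_zero]
    | succ n ih =>
      rw [poch_succ, norm_mul, Nat.ascFactorial_succ, mul_comm]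
      push_cast
      refine mul_le_mul ?_ ih (norm_nonneg _) (by positivity)
      calc ‖a + j + n‖ ≤ ‖a‖ + ‖(j : ℂ)‖ + ‖(n : ℂ)‖ := norm_add₃_le
        _ ≤ _ := by simp; linarith
  have hi : (0 : ℝ) < (Nat.factorial i : ℝ) := by exact_mod_cast Nat.factorial_pos i
  rw [qp, norm_div, Complex.norm_natCast, div_le_iff₀ hi]
  refine h1.trans ?_
  rw [Nat.ascFactorial_eq_factorial_mul_choose']
  push_cast
  rw [mul_comm]
  refine mul_le_mul_of_nonneg_right ?_ hi.le
  have h2 : (A + j + i - 1).choose i ≤ 2 ^ (A + i + j) :=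
    (Nat.choose_le_two_pow _ _).trans (Nat.pow_le_pow_right (by norm_num) (by omega))
  calc (((A + j + i - 1).choose i : ℕ) : ℝ) ≤ ((2 ^ (A + i + j) : ℕ) : ℝ) := by exact_mod_cast h2
    _ = _ := by push_cast; ring

lemma ratio_bound (b c : ℂ) (hc : ∀ n : ℕ, c ≠ -(n : ℂ)) :
    ∃ K : ℝ, 0 ≤ K ∧ ∀ n : ℕ, ‖poch b n / poch c n‖ ≤ K * (6 / 5) ^ n := by
  have hs : Summable (fun n => poch b n / poch c n * (5 / 6 : ℂ) ^ n) := by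
    refine summable_of_ratio_norm_eventually_le (r := 11 / 12) (by norm_num) ?_
    obtain ⟨N, hN⟩ := exists_nat_ge (10 * ‖b‖ + 11 * ‖c‖)
    filter_upwards [Filter.eventually_ge_atTop N] with n hn
    have hn' : (N : ℝ) ≤ n := by exact_mod_cast hn
    have hcn : c + n ≠ 0 := fun h => hc n (eq_neg_of_add_eq_zero_left h)
    have hcn' : 0 < ‖c + n‖ := norm_pos_iff.mpr hcn
    have e : poch b (n + 1) / poch c (n + 1) * (5 / 6 : ℂ) ^ (n + 1) =
        ((b + n) / (c + n) * (5 / 6)) * (poch b n / poch c n * (5 / 6 : ℂ) ^ n) := by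
      rw [poch_succ, poch_succ, pow_succ, mul_div_mul_comm]
      ring
    rw [e, norm_mul]
    refine mul_le_mul_of_nonneg_right ?_ (norm_nonneg _)
    have h1 : ‖b + n‖ ≤ ‖b‖ + n := by
      simpa using norm_add_le b (n : ℂ)
    have h2 : (n : ℝ) - ‖c‖ ≤ ‖c + n‖ := by
      have := norm_sub_le (c + n) c
      simp at this
      linarith
    rw [norm_mul, norm_div]
    have h3 : ‖(5 / 6 : ℂ)‖ = 5 / 6 := by simp
    rw [h3]
    have h4 : ‖b + n‖ / ‖c + n‖ ≤ 11 / 10 := by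
      rw [div_le_iff₀ hcn']
      linarith
    linarith
  obtain ⟨K, hK⟩ := hs.tendsto_atTop_zero.norm.bddAbove_range
  refine ⟨max K 0, le_max_right _ _, fun n => ?_⟩
  have h := hK ⟨n, rfl⟩
  simp only [norm_mul, norm_pow] at h
  have h3 : ‖(5 / 6 : ℂ)‖ = 5 / 6 := by simp
  rw [h3] at h
  have h5 : ((5 / 6 : ℝ) ^ n) * (6 / 5) ^ n = 1 := by
    rw [← mul_pow]; norm_num
  calc ‖poch b n / poch c n‖ = (‖poch b n / poch c n‖ * (5 / 6) ^ n) * (6 / 5) ^ n := by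
        rw [mul_assoc, h5, mul_one]
    _ ≤ _ := mul_le_mul_of_nonneg_right (h.trans (le_max_left _ _)) (by positivity)

lemma qp_ratio_bound (b : ℂ) :
    ∃ K : ℝ, 0 ≤ K ∧ ∀ n : ℕ, ‖qp b n‖ ≤ K * (6 / 5) ^ n := by
  have := ratio_bound b 1 (by
    intro n h
    have h2 : ((1 + n : ℕ) : ℂ) = 0 := by push_cast; rw [h]; ring
    have h3 := Nat.cast_eq_zero.mp h2
    omega)
  simpa only [poch_one, qp] using this

lemma summable_geom2 (K r s : ℝ) (hr0 : 0 ≤ r) (hr : r < 1) (hs0 : 0 ≤ s) (hs : s < 1) :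
    Summable (fun ij : ℕ × ℕ => K * (r ^ ij.1 * s ^ ij.2)) :=
  ((summable_geometric_of_lt_one hr0 hr).mul_of_nonneg (summable_geometric_of_lt_one hs0 hs)
    (fun _ => by positivity) (fun _ => by positivity)).mul_left K

lemma F2term_eq (a b b' c x z : ℂ) (ha : ∀ n : ℕ, a ≠ -(n : ℂ)) (i j : ℕ) :
    F2term a b b' c a x z (i, j) =
      (poch b i / poch c i * x ^ i) * (qp (a + j) i * qp b' j * z ^ j) := by
  have h := poch_ne_zero a ha j
  have e : poch a (i + j) = poch a j * poch (a + j) i := by rw [add_comm, poch_add]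
  simp only [F2term, qp, e]
  rw [show poch a j * poch (a + j) i * poch b i * poch b' j =
    poch a j * (poch (a + j) i * poch b i * poch b' j) by ring,
    show poch c i * poch a j * (Nat.factorial i : ℂ) * (Nat.factorial j : ℂ) =
    poch a j * (poch c i * (Nat.factorial i : ℂ) * (Nat.factorial j : ℂ)) by ring,
    mul_div_mul_left _ _ h]
  simp only [div_eq_mul_inv, mul_inv]
  ring

lemma F1term_eq (a b b' c x w : ℂ) (i j : ℕ) :
    F1term b (a - b') b' c x (x * w) (i, j) =
      (poch b (i + j) / poch c (i + j) * x ^ (i + j)) *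
        (qp (a - b') i * qp b' j * w ^ j) := by
  simp only [F1term, qp, div_eq_mul_inv, mul_inv, mul_pow, pow_add]
  ring

lemma inner_hasSum (a b' y : ℂ) (hy : ‖y‖ < 1 / 4) (hz : ‖-y / (1 - y)‖ ≤ 1 / 3) (i : ℕ) :
    HasSum (fun j : ℕ => qp (a + j) i * qp b' j * (-y / (1 - y)) ^ j)
      ((1 - y) ^ b' * ∑ kl ∈ Finset.HasAntidiagonal.antidiagonal i,
        qp (a - b') kl.1 * qp b' kl.2 * (1 - y) ^ kl.2) := by
  have hre : 0 < (1 - y).re := by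
    have := Complex.re_le_norm y
    simp; linarith
  have hne : (1 - y) ≠ 0 := by
    intro h; rw [h] at hre; simp at hre
  have harg : (1 - y).arg ≠ Real.pi := by
    intro h
    rw [Complex.arg_eq_pi_iff] at h
    linarith [h.1]
  have h1z : 1 - -y / (1 - y) = (1 - y)⁻¹ := by field_simp; ring
  have key : ∀ l : ℕ, 1 / (1 - -y / (1 - y)) ^ (b' + l) = (1 - y) ^ b' * (1 - y) ^ l := by
    intro l
    rw [h1z, Complex.inv_cpow _ _ harg, one_div, inv_inv, Complex.cpow_add _ _ hne,
      Complex.cpow_natCast]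
  rw [Finset.mul_sum]
  have hterm : ∀ j : ℕ, qp (a + j) i * qp b' j * (-y / (1 - y)) ^ j =
      ∑ kl ∈ Finset.HasAntidiagonal.antidiagonal i, (qp (a - b') kl.1 * qp b' kl.2) *
        (qp (b' + kl.2) j * (-y / (1 - y)) ^ j) := by
    intro j
    rw [show a + j = (a - b') + (b' + j) by ring, qp_add, Finset.sum_mul, Finset.sum_mul]
    refine Finset.sum_congr rfl fun kl _ => ?_
    have := qp_swap b' j kl.2
    linear_combination qp (a - b') kl.1 * (-y / (1 - y)) ^ j * this
  simp_rw [hterm]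
  refine hasSum_sum fun kl _ => ?_
  have h := (qp_hasSum (b' + kl.2) (-y / (1 - y)) (by linarith)).mul_left
    (qp (a - b') kl.1 * qp b' kl.2)
  rw [key] at h
  have e : ∀ p q r t : ℂ, p * (q * r * t) = q * r * (p * t) := by intros; ring
  rw [e]
  exact h

/-- Fact 1.5 (Bailey): `(1−y)^(−b') F₂(a,b,b',c,a; x, −y/(1−y)) = F₁(b, a−b', b', c; x, x(1−y))`,
together with the absolute convergence of both double series, for `|x| < 1/4`, `|y| < 1/4`,
and `c`, `a` not nonpositive integers. -/
theorem stmt4 (a b b' c : ℂ)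
    (hc : ∀ n : ℕ, c ≠ -(n : ℂ)) (ha : ∀ n : ℕ, a ≠ -(n : ℂ))
    (x y : ℂ) (hx : ‖x‖ < 1 / 4) (hy : ‖y‖ < 1 / 4) :
    Summable (fun ij : ℕ × ℕ => ‖F2term a b b' c a x (-y / (1 - y)) ij‖) ∧
    Summable (fun ij : ℕ × ℕ => ‖F1term b (a - b') b' c x (x * (1 - y)) ij‖) ∧
    (1 - y) ^ (-b') * ∑' ij : ℕ × ℕ, F2term a b b' c a x (-y / (1 - y)) ij =
      ∑' ij : ℕ × ℕ, F1term b (a - b') b' c x (x * (1 - y)) ij := by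
  have hz : ‖-y / (1 - y)‖ ≤ 1 / 3 := by
    have h1 : 3 / 4 ≤ ‖1 - y‖ := by
      have := norm_sub_norm_le (1 : ℂ) y
      simp at this
      linarith
    rw [norm_div, norm_neg, div_le_iff₀ (by linarith)]
    linarith
  have hw : ‖1 - y‖ ≤ 5 / 4 := by
    have := norm_sub_le (1 : ℂ) y
    simp at this
    linarith
  obtain ⟨K, hK0, hK⟩ := ratio_bound b c hc
  obtain ⟨L, hL0, hL⟩ := qp_ratio_bound b'
  obtain ⟨M, hM0, hM⟩ := qp_ratio_bound (a - b')
  obtain ⟨A, hA⟩ := qp_bound a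
  have S2 : Summable (fun ij : ℕ × ℕ => ‖F2term a b b' c a x (-y / (1 - y)) ij‖) := by
    refine Summable.of_nonneg_of_le (fun _ => norm_nonneg _) ?_
      (summable_geom2 (K * L * 2 ^ A) (3 / 5) (4 / 5)
        (by norm_num) (by norm_num) (by norm_num) (by norm_num))
    rintro ⟨i, j⟩
    rw [F2term_eq a b b' c x _ ha]
    simp only [norm_mul, norm_pow]
    calc _ ≤ (K * (6 / 5) ^ i * (1 / 4) ^ i) *
          ((2 ^ A * 2 ^ i * 2 ^ j) * (L * (6 / 5) ^ j) * (1 / 3) ^ j) := by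
          gcongr
          · exact hK i
          · exact hA i j
          · exact hL j
      _ = K * L * 2 ^ A * (((6 / 5) * (1 / 4) * 2) ^ i * (2 * (6 / 5) * (1 / 3)) ^ j) := by
          simp only [mul_pow]; ring
      _ = _ := by norm_num
  have S1 : Summable (fun ij : ℕ × ℕ => ‖F1term b (a - b') b' c x (x * (1 - y)) ij‖) := by
    refine Summable.of_nonneg_of_le (fun _ => norm_nonneg _) ?_
      (summable_geom2 (K * L * M) (9 / 25) (9 / 20)
        (by norm_num) (by norm_num) (by norm_num) (by norm_num))
    rintro ⟨i, j⟩
    rw [F1term_eq]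
    simp only [norm_mul, norm_pow]
    calc _ ≤ (K * (6 / 5) ^ (i + j) * (1 / 4) ^ (i + j)) *
          ((M * (6 / 5) ^ i) * (L * (6 / 5) ^ j) * (5 / 4) ^ j) := by
          gcongr
          · exact hK _
          · exact hM i
          · exact hL j
      _ = K * L * M * (((6 / 5) * (1 / 4) * (6 / 5)) ^ i *
            ((6 / 5) * (1 / 4) * (6 / 5) * (5 / 4)) ^ j) := by
          simp only [mul_pow, pow_add]; ring
      _ = _ := by norm_num
  refine ⟨S2, S1, ?_⟩
  have hne : (1 - y) ≠ 0 := by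
    intro h
    have : y = 1 := (sub_eq_zero.mp h).symm
    rw [this] at hy
    norm_num at hy
  have T2 := S2.of_norm
  have T1 := S1.of_norm
  rw [T2.tsum_prod, ← tsum_mul_left,
    ← Finset.HasAntidiagonal.sigmaAntidiagonalEquivProd.tsum_eq
      (F1term b (a - b') b' c x (x * (1 - y)))]
  have T1' : Summable (fun p => F1term b (a - b') b' c x (x * (1 - y))
      (Finset.HasAntidiagonal.sigmaAntidiagonalEquivProd p)) :=
    Finset.HasAntidiagonal.sigmaAntidiagonalEquivProd.summable_iff.mpr T1
  rw [T1'.tsum_sigma]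
  refine tsum_congr fun i => ?_
  simp_rw [F2term_eq a b b' c x _ ha]
  rw [tsum_mul_left, (inner_hasSum a b' y hy hz i).tsum_eq, tsum_fintype]
  have hpow : (1 - y) ^ (-b') * (1 - y) ^ b' = 1 := by
    rw [← Complex.cpow_add _ _ hne]; simp
  have hR : ∑ kl : Finset.HasAntidiagonal.antidiagonal i, F1term b (a - b') b' c x (x * (1 - y))
      (Finset.HasAntidiagonal.sigmaAntidiagonalEquivProd ⟨i, kl⟩) =
      (poch b i / poch c i * x ^ i) * ∑ kl ∈ Finset.HasAntidiagonal.antidiagonal i,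
        qp (a - b') kl.1 * qp b' kl.2 * (1 - y) ^ kl.2 := by
    rw [Finset.mul_sum, ← Finset.sum_coe_sort (Finset.HasAntidiagonal.antidiagonal i)]
    refine Finset.sum_congr rfl ?_
    rintro ⟨⟨k, l⟩, hkl⟩ _
    have e := Finset.HasAntidiagonal.mem_antidiagonal.mp hkl
    simp only at e
    have := F1term_eq a b b' c x (1 - y) k l
    rw [e] at this
    exact this
  refine Eq.trans ?_ hR.symm
  linear_combination (poch b i / poch c i * x ^ i) * (∑ kl ∈ Finset.HasAntidiagonal.antidiagonal i,
        qp (a - b') kl.1 * qp b' kl.2 * (1 - y) ^ kl.2) * hpow
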